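/- Let 0 < s < 1, p ≥ 1 and N > ps, and set p*_s = pN/(N − ps). Then there exists a constant S = S(N, p, s) > 0 such that for every φ ∈ C_c^∞(ℝ^N), S ‖φ‖_{L^{p*_s}(ℝ^N)} ≤ ( ∬_{ℝ^N×ℝ^N} |φ(x) − φ(y)|^p / |x−y|^{N+sp} dx dy )^{1/p}. -/

import Mathlib

open MeasureTheory

section Gagliardo

open Metric Module

theorem LipschitzWith.exists_abs_sub_rpow_le {E : Type*} [NormedAddCommGroup E] {φ : E → ℝ}
    {p : ℝ} {K : NNReal} (hφ : LipschitzWith K φ) (hc : HasCompactSupport φ) (hp : 0 < p) :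
    ∃ C : ℝ, 0 ≤ C ∧ ∀ x y, |φ x - φ y| ^ p ≤ C * min (‖x - y‖ ^ p) 1 := by
  obtain ⟨M, hM⟩ := hc.exists_bound_of_continuous hφ.continuous
  have hM0 : 0 ≤ M := (norm_nonneg _).trans (hM 0)
  refine ⟨max (K : ℝ) (2 * M) ^ p, by positivity, fun x y ↦ ?_⟩
  rw [mul_min_of_nonneg _ _ (by positivity), ← Real.mul_rpow (by positivity) (by positivity),
    mul_one]
  refine le_min (Real.rpow_le_rpow (abs_nonneg _) ?_ hp.le)
    (Real.rpow_le_rpow (abs_nonneg _) ?_ hp.le)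
  · have := hφ.dist_le_mul x y
    rw [dist_eq_norm, dist_eq_norm, Real.norm_eq_abs] at this
    exact this.trans (mul_le_mul_of_nonneg_right (le_max_left _ _) (norm_nonneg _))
  · refine le_trans ?_ (le_max_right _ _)
    have h1 := hM x
    have h2 := hM y
    rw [Real.norm_eq_abs] at h1 h2
    linarith [abs_sub (φ x) (φ y)]

variable {E : Type*} [NormedAddCommGroup E] [NormedSpace ℝ E] [FiniteDimensional ℝ E]
  [MeasurableSpace E] [BorelSpace E] {μ : Measure E} [μ.IsAddHaarMeasure] {φ : E → ℝ} {s p : ℝ}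

theorem integrable_min_rpow_norm_div [Nontrivial E] (hs0 : 0 < s) (hs1 : s < 1) (hp : 0 < p) :
    Integrable (fun z : E ↦ min (‖z‖ ^ p) 1 / ‖z‖ ^ ((finrank ℝ E : ℝ) + s * p)) μ := by
  rw [integrable_fun_norm_addHaar μ
    (f := fun r : ℝ ↦ min (r ^ p) 1 / r ^ ((finrank ℝ E : ℝ) + s * p)),
    ← Set.Ioc_union_Ioi_eq_Ioi zero_le_one]
  have hN : 1 ≤ finrank ℝ E := finrank_pos
  have key : ∀ r : ℝ, 0 < r → r ^ (finrank ℝ E - 1) • (min (r ^ p) 1 /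
      r ^ ((finrank ℝ E : ℝ) + s * p)) = min (r ^ p) 1 * r ^ (-1 - s * p) := by
    intro r hr
    rw [smul_eq_mul, ← Real.rpow_natCast, Nat.cast_sub hN, div_eq_mul_inv,
      ← Real.rpow_neg hr.le, mul_left_comm, ← Real.rpow_add hr]
    congr 2
    push_cast
    ring
  refine IntegrableOn.union ?_ ?_
  · refine IntegrableOn.congr_fun (f := fun r : ℝ ↦ r ^ (p - s * p - 1)) ?_ ?_ measurableSet_Ioc
    · refine (intervalIntegrable_iff_integrableOn_Ioc_of_le zero_le_one).1
        (intervalIntegral.intervalIntegrable_rpow' ?_)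
      nlinarith
    · intro r hr
      simp only
      rw [key r hr.1, min_eq_left (Real.rpow_le_one hr.1.le hr.2 hp.le), ← Real.rpow_add hr.1]
      congr 1
      ring
  · refine IntegrableOn.congr_fun (f := fun r : ℝ ↦ r ^ (-1 - s * p)) ?_ ?_ measurableSet_Ioi
    · refine integrableOn_Ioi_rpow_of_lt ?_ zero_lt_one
      nlinarith
    · intro r hr
      have hr1 : (1 : ℝ) < r := hr
      simp only
      rw [key r (by linarith), min_eq_right (Real.one_le_rpow hr1.le hp.le), one_mul]

theorem LipschitzWith.integrable_gagliardo_left [Nontrivial E] {K : NNReal}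
    (hφ : LipschitzWith K φ) (hc : HasCompactSupport φ) (hs0 : 0 < s) (hs1 : s < 1) (hp : 0 < p)
    (x : E) :
    Integrable (fun y ↦ |φ x - φ y| ^ p / ‖x - y‖ ^ ((finrank ℝ E : ℝ) + s * p)) μ := by
  obtain ⟨C, hC0, hC⟩ := hφ.exists_abs_sub_rpow_le hc hp
  have hk := ((integrable_min_rpow_norm_div (μ := μ) hs0 hs1 hp).comp_sub_right x).const_mul C
  have hm := hφ.continuous.measurable
  refine hk.mono' (Measurable.aestronglyMeasurable (by fun_prop)) (.of_forall fun y ↦ ?_)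
  rw [Real.norm_of_nonneg (by positivity), norm_sub_rev y x, ← mul_div_assoc]
  gcongr
  exact hC x y

theorem LipschitzWith.integrable_gagliardo_prod [Nontrivial E] {K : NNReal}
    (hφ : LipschitzWith K φ) (hc : HasCompactSupport φ) (hs0 : 0 < s) (hs1 : s < 1) (hp : 0 < p) :
    Integrable (fun z : E × E ↦
      |φ z.1 - φ z.2| ^ p / ‖z.1 - z.2‖ ^ ((finrank ℝ E : ℝ) + s * p)) (μ.prod μ) := by
  obtain ⟨C, hC0, hC⟩ := hφ.exists_abs_sub_rpow_le hc hp
  have hk := (integrable_min_rpow_norm_div (E := E) (μ := μ) hs0 hs1 hp).const_mul C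
  have hi : Integrable ((tsupport φ).indicator (fun _ ↦ (1 : ℝ))) μ :=
    (integrable_indicator_iff (isClosed_tsupport φ).measurableSet).2
      (integrableOn_const (IsCompact.measure_lt_top hc).ne)
  have h1 := hi.convolution_integrand (ContinuousLinearMap.mul ℝ ℝ) hk
  have hm := hφ.continuous.measurable
  refine (h1.add h1.swap).mono' (Measurable.aestronglyMeasurable (by fun_prop))
    (.of_forall fun z ↦ ?_)
  obtain ⟨x, y⟩ := z
  have hle : |φ x - φ y| ^ p / ‖x - y‖ ^ ((finrank ℝ E : ℝ) + s * p) ≤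
      C * (min (‖x - y‖ ^ p) 1 / ‖x - y‖ ^ ((finrank ℝ E : ℝ) + s * p)) := by
    rw [← mul_div_assoc]
    gcongr
    exact hC x y
  rw [Real.norm_of_nonneg (by positivity)]
  simp only [Pi.add_apply, Function.comp_apply, Prod.swap_prod_mk, ContinuousLinearMap.mul_apply',
    norm_sub_rev y x]
  have h0 : 0 ≤ C * (min (‖x - y‖ ^ p) 1 / ‖x - y‖ ^ ((finrank ℝ E : ℝ) + s * p)) := by
    positivity
  by_cases hx : x ∈ tsupport φ <;> by_cases hy : y ∈ tsupport φ
  · simp only [hx, hy, Set.indicator_of_mem]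
    linarith
  · simpa [hx, hy] using hle
  · simpa [hx, hy] using hle
  · simp [image_eq_zero_of_notMem_tsupport hx, image_eq_zero_of_notMem_tsupport hy,
      Real.zero_rpow hp.ne', hx, hy]

/-- The part of the ball around `x` of volume `2 m` on which `|φ| < |φ x| / 2` has measure at
least `m`, where `m` is the Chebyshev bound for the measure of `{|φ x| / 2 ≤ |φ|}`. -/
theorem abs_rpow_le_gagliardo [Nontrivial E] {q : ℝ} (hs0 : 0 < s) (hp : 0 < p)
    (hq : q = p + q * (s * p / finrank ℝ E)) (hq0 : 0 < q) (hφ : Continuous φ)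
    (hqi : Integrable (fun y ↦ |φ y| ^ q) μ) (hA : 0 < ∫ y, |φ y| ^ q ∂μ) (x : E)
    (hG : Integrable (fun y ↦ |φ x - φ y| ^ p / ‖x - y‖ ^ ((finrank ℝ E : ℝ) + s * p)) μ) :
    |φ x| ^ q ≤ 2 ^ q * (2 / μ.real (ball 0 1)) ^ (1 + s * p / finrank ℝ E) *
      (∫ y, |φ y| ^ q ∂μ) ^ (s * p / finrank ℝ E) *
      ∫ y, |φ x - φ y| ^ p / ‖x - y‖ ^ ((finrank ℝ E : ℝ) + s * p) ∂μ := by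
  set A := ∫ y, |φ y| ^ q ∂μ
  set ω := μ.real (ball (0 : E) 1)
  set d : ℝ := (finrank ℝ E : ℝ) with hd
  set a := s * p / d with ha
  have hdpos : 0 < d := by rw [hd]; exact_mod_cast finrank_pos
  have hω : 0 < ω := ENNReal.toReal_pos (measure_ball_pos μ _ one_pos).ne' measure_ball_lt_top.ne
  have hG0 : 0 ≤ ∫ y, |φ x - φ y| ^ p / ‖x - y‖ ^ (d + s * p) ∂μ :=
    integral_nonneg fun y ↦ by positivity
  rcases eq_or_ne (φ x) 0 with hx | hx
  · rw [hx, abs_zero, Real.zero_rpow hq0.ne']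
    positivity
  set u := |φ x| / 2 with hu
  have hu0 : 0 < u := by positivity
  set m := A / u ^ q with hm
  have hm0 : 0 < m := by positivity
  set r := (2 / ω * m) ^ (1 / d) with hr
  have hr0 : 0 < r := by positivity
  have hrd : r ^ finrank ℝ E = 2 / ω * m := by
    rw [hr, ← Real.rpow_natCast, ← Real.rpow_mul (by positivity), ← hd, one_div_mul_cancel hdpos.ne',
      Real.rpow_one]
  have hrs : r ^ (d + s * p) = (2 / ω * m) ^ (1 + a) := by
    rw [hr, ← Real.rpow_mul (by positivity)]
    congr 1
    rw [ha]
    field_simp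
  set T := {y | u ^ q ≤ |φ y| ^ q}
  have hTm : μ.real T ≤ m := by
    rw [hm, le_div_iff₀' (by positivity)]
    exact mul_meas_ge_le_integral_of_nonneg (.of_forall fun y ↦ by positivity) hqi _
  have hTfin : μ T ≠ ⊤ := (hqi.measure_ge_lt_top (by positivity)).ne
  have hball : μ.real (ball x r) = 2 * m := by
    rw [measureReal_def, Measure.addHaar_ball_of_pos μ x hr0, ENNReal.toReal_mul,
      ENNReal.toReal_ofReal (by positivity), hrd, ← measureReal_def]
    change 2 / ω * m * ω = 2 * m
    field_simp
  have hBm : m ≤ μ.real (ball x r \ T) := by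
    have := le_measureReal_sdiff (μ := μ) (s₁ := ball x r) hTfin
    linarith
  have hTmeas : MeasurableSet T :=
    measurableSet_le measurable_const (by have := hφ.measurable; fun_prop)
  have hpt : ∀ y ∈ ball x r \ T, u ^ p / r ^ (d + s * p) ≤
      |φ x - φ y| ^ p / ‖x - y‖ ^ (d + s * p) := by
    rintro y ⟨hy, hyT⟩
    have hyu : |φ y| < u := by
      by_contra! h
      exact hyT (Real.rpow_le_rpow hu0.le h hq0.le)
    have hdiff : u ≤ |φ x - φ y| := by
      have := abs_sub_abs_le_abs_sub (φ x) (φ y)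
      linarith
    have hxy : 0 < ‖x - y‖ := by
      rw [norm_pos_iff, sub_ne_zero]
      rintro rfl
      linarith
    rw [mem_ball', dist_eq_norm] at hy
    gcongr
  have hlow : m * (u ^ p / r ^ (d + s * p)) ≤
      ∫ y, |φ x - φ y| ^ p / ‖x - y‖ ^ (d + s * p) ∂μ :=
    calc
      _ ≤ u ^ p / r ^ (d + s * p) * μ.real (ball x r \ T) := by
        rw [mul_comm]
        gcongr
      _ ≤ ∫ y in ball x r \ T, |φ x - φ y| ^ p / ‖x - y‖ ^ (d + s * p) ∂μ :=
        setIntegral_ge_of_const_le_real (measurableSet_ball.diff hTmeas)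
          (measure_ne_top_of_subset Set.sdiff_subset measure_ball_lt_top.ne) hpt hG.integrableOn
      _ ≤ _ := setIntegral_le_integral hG (.of_forall fun y ↦ by positivity)
  have hid : |φ x| ^ q = 2 ^ q * (2 / ω) ^ (1 + a) * A ^ a * (m * (u ^ p / r ^ (d + s * p))) := by
    have hA' : A ^ a = m ^ a * u ^ (q * a) := by
      rw [Real.rpow_mul hu0.le, ← Real.mul_rpow hm0.le (by positivity), hm,
        div_mul_cancel₀ _ (by positivity)]
    have hφu : |φ x| = 2 * u := by rw [hu]; ring
    have huq : u ^ q = u ^ p * u ^ (q * a) := by rw [← Real.rpow_add hu0, ← hq]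
    rw [hφu, Real.mul_rpow two_pos.le hu0.le, huq, hrs, Real.mul_rpow (by positivity) hm0.le,
      Real.rpow_add hm0, Real.rpow_one, hA']
    field_simp
  rw [hid]
  gcongr

end Gagliardo

/-- Fractional Sobolev inequality with the Gagliardo seminorm: for
`0 < s < 1`, `p ≥ 1`, `N > ps` and `p*_s = pN/(N − ps)`, there is `S = S(N,p,s) > 0` such
that for every `φ ∈ C_c^∞(ℝ^N)`,
`S ‖φ‖_{L^{p*_s}} ≤ (∬ |φ(x)−φ(y)|^p / |x−y|^{N+sp} dx dy)^{1/p}`. -/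
theorem fractional_sobolev_gagliardo (N : ℕ) (s p : ℝ)
    (hs0 : 0 < s) (hs1 : s < 1) (hp : 1 ≤ p) (hps : p * s < N) :
    ∃ S > 0, ∀ φ : EuclideanSpace ℝ (Fin N) → ℝ,
      ContDiff ℝ (⊤ : ℕ∞) φ → HasCompactSupport φ →
      S * (∫ x : EuclideanSpace ℝ (Fin N),
              |φ x| ^ (p * N / ((N : ℝ) - p * s))) ^ (((N : ℝ) - p * s) / (p * N))
        ≤ (∫ x : EuclideanSpace ℝ (Fin N), ∫ y : EuclideanSpace ℝ (Fin N),
              |φ x - φ y| ^ p / ‖x - y‖ ^ ((N : ℝ) + s * p)) ^ (1 / p) := by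
  have hps' : 0 < (N : ℝ) - p * s := by linarith
  have hp0 : 0 < p := by linarith
  have hNpos : (0 : ℝ) < N := by nlinarith [mul_pos hp0 hs0]
  have : Nonempty (Fin N) := Fin.pos_iff_nonempty.1 (by exact_mod_cast hNpos)
  let E := EuclideanSpace ℝ (Fin N)
  set q := p * N / ((N : ℝ) - p * s) with hq
  set c : ℝ := 2 ^ q * (2 / volume.real (Metric.ball (0 : E) 1)) ^ (1 + s * p / N) with hc
  have hω : 0 < volume.real (Metric.ball (0 : E) 1) :=
    ENNReal.toReal_pos (Metric.measure_ball_pos volume _ one_pos).ne' measure_ball_lt_top.ne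
  have hc0 : 0 < c := by positivity
  have hq0 : 0 < q := by positivity
  refine ⟨(c ^ (1 / p))⁻¹, by positivity, fun φ hφ hφc ↦ ?_⟩
  obtain ⟨K, hK⟩ := hφ.lipschitzWith_of_hasCompactSupport hφc (by simp)
  have hG := fun x ↦ hK.integrable_gagliardo_left (μ := volume) hφc hs0 hs1 hp0 x
  have hGG := (hK.integrable_gagliardo_prod (μ := volume) hφc hs0 hs1 hp0).integral_prod_left
  have hpt := abs_rpow_le_gagliardo (φ := φ) (μ := volume) (q := q) hs0 hp0
  simp only [finrank_euclideanSpace_fin] at hG hGG hpt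
  set A := ∫ x : E, |φ x| ^ q with hA
  set D := ∫ x : E, ∫ y : E, |φ x - φ y| ^ p / ‖x - y‖ ^ ((N : ℝ) + s * p) with hD
  have hD0 : 0 ≤ D := integral_nonneg fun x ↦ integral_nonneg fun y ↦ by positivity
  have hA0 : 0 ≤ A := integral_nonneg fun x ↦ by positivity
  rcases hA0.eq_or_lt with hA' | hA'
  · rw [← hA', Real.zero_rpow (by positivity), mul_zero]
    positivity
  have hqi : Integrable (fun y : E ↦ |φ y| ^ q) :=
    (hφ.continuous.abs.rpow_const fun _ ↦ .inr hq0.le).integrable_of_hasCompactSupport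
      (hφc.comp_left (g := fun t : ℝ ↦ |t| ^ q) (by simp [Real.zero_rpow hq0.ne']))
  have hqe : q = p + q * (s * p / N) := by
    rw [hq]
    field_simp
    ring
  have hint : A ≤ c * A ^ (s * p / N) * D := by
    rw [hD, ← integral_const_mul]
    exact integral_mono hqi (hGG.const_mul _)
      fun x ↦ hpt hqe hq0 hφ.continuous hqi hA' x (hG x)
  have hbound : A ^ (((N : ℝ) - p * s) / N) ≤ c * D := by
    have he : ((N : ℝ) - p * s) / N = 1 - s * p / N := by
      field_simp
    rw [he, Real.rpow_sub hA', Real.rpow_one, div_le_iff₀ (by positivity)]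
    linarith
  have he : ((N : ℝ) - p * s) / (p * N) = ((N : ℝ) - p * s) / N * (1 / p) := by
    field_simp
  rw [inv_mul_le_iff₀ (by positivity), ← Real.mul_rpow hc0.le hD0, he, Real.rpow_mul hA0]
  gcongr
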